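/- There exists a constant C > 0 depending only on g and M such that for every real λ > 1 there is a threshold n₀ with: for every integer n ≥ n₀, ∑_{x ∈ T_n^{ind}} ∏_{i=1}^{2g+4} λ^{-1} x_i^{-α} ≤ C · λ · log n. -/

import Mathlib

noncomputable section

open Real MeasureTheory ProbabilityTheory

def IsSidonZ {M : ℕ} (S : Set (ZMod M)) : Prop :=
  ∀ a ∈ S, ∀ b ∈ S, ∀ c ∈ S, ∀ d ∈ S, a + b = c + d → ({a, b} : Set (ZMod M)) = {c, d}

def Covers3 {M : ℕ} (S : Set (ZMod M)) : Prop :=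
  ∀ z : ZMod M, ∃ s₁ ∈ S, ∃ s₂ ∈ S, ∃ s₃ ∈ S,
    s₁ ≠ s₂ ∧ s₁ ≠ s₃ ∧ s₂ ≠ s₃ ∧ z = s₁ + s₂ + s₃

def alph (g : ℕ) : ℝ := ((g : ℝ) + 1) / (2 * (g : ℝ) + 1)

def glam (g : ℕ) (lam : ℝ) (n : ℕ) : ℝ :=
  lam ^ ((2 * (g : ℝ) + 5) / (1 - alph g)) * (n : ℝ) ^ ((1 : ℝ) / (g : ℝ)) *
    Real.log n ^ ((1 : ℝ) / (1 - alph g))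

def GoodS (M : ℕ) (CM : Set (ZMod M)) (s : ℕ → Fin 3 → ZMod M) : Prop :=
  ∀ n : ℕ, (∀ i, s n i ∈ CM) ∧ s n 0 ≠ s n 1 ∧ s n 0 ≠ s n 2 ∧ s n 1 ≠ s n 2 ∧
    s n 0 + s n 1 + s n 2 = (n : ZMod M)

def Rtrip (g M : ℕ) (lam : ℝ) (s : ℕ → Fin 3 → ZMod M) (n x₁ x₂ x₃ : ℕ) : Prop :=
  0 < x₁ ∧ 0 < x₂ ∧ 0 < x₃ ∧ x₁ + x₂ + x₃ = n ∧
  glam g lam n / 2 ≤ (x₁ : ℝ) ∧ (x₁ : ℝ) ≤ glam g lam n ∧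
  (n : ℝ) / 4 ≤ (x₂ : ℝ) ∧ x₂ ≤ n ∧ (n : ℝ) / 4 ≤ (x₃ : ℝ) ∧ x₃ ≤ n ∧
  (x₁ : ZMod M) = s n 0 ∧ (x₂ : ZMod M) = s n 1 ∧ (x₃ : ZMod M) = s n 2

def Rn (g M : ℕ) (lam : ℝ) (s : ℕ → Fin 3 → ZMod M) (n : ℕ) : Set (Finset ℕ) :=
  {ω | ∃ x₁ x₂ x₃ : ℕ, ω = {x₁, x₂, x₃} ∧ Rtrip g M lam s n x₁ x₂ x₃}

def imgF {m : ℕ} (x : Fin m → ℕ) : Finset ℕ := Finset.image x Finset.univ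

def firstThree (g : ℕ) (x : Fin (2 * g + 4) → ℕ) : Finset ℕ :=
  {x ⟨0, by omega⟩, x ⟨1, by omega⟩, x ⟨2, by omega⟩}

def pairOf (g : ℕ) (x : Fin (2 * g + 4) → ℕ) (j : ℕ) : Finset ℕ :=
  if j = 0 then {x ⟨0, by omega⟩, x ⟨3, by omega⟩}
  else if h : j ≤ g then {x ⟨2 * j + 2, by omega⟩, x ⟨2 * j + 3, by omega⟩}
  else ∅

def Tn (g M : ℕ) (lam : ℝ) (s : ℕ → Fin 3 → ZMod M) (n : ℕ) :
    Set (Fin (2 * g + 4) → ℕ) :=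
  {x | (∀ i, 0 < x i) ∧
    firstThree g x ∈ Rn g M lam s n ∧
    (∀ j : ℕ, 2 ≤ j → ∀ _ : j ≤ g + 1,
      x ⟨0, by omega⟩ + x ⟨3, by omega⟩ = x ⟨2 * j, by omega⟩ + x ⟨2 * j + 1, by omega⟩) ∧
    (∀ i : Fin (2 * g + 4), 3 ≤ (i : ℕ) → x i ≤ x ⟨0, by omega⟩) ∧
    (∀ k : ℕ, 2 ≤ k → ∀ _ : k ≤ g + 1,
      (x ⟨2 * k, by omega⟩ : ZMod M) = (x ⟨0, by omega⟩ : ZMod M) ∧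
      (x ⟨2 * k + 1, by omega⟩ : ZMod M) = (x ⟨3, by omega⟩ : ZMod M)) ∧
    (∀ j k : ℕ, j ≤ g → k ≤ g → j ≠ k → pairOf g x j ≠ pairOf g x k)}

def TnInd (g M : ℕ) (lam : ℝ) (s : ℕ → Fin 3 → ZMod M) (n : ℕ) :
    Set (Fin (2 * g + 4) → ℕ) :=
  {x ∈ Tn g M lam s n | Function.Injective x}

def TnDep (g M : ℕ) (lam : ℝ) (s : ℕ → Fin 3 → ZMod M) (n : ℕ) :
    Set (Fin (2 * g + 4) → ℕ) :=
  {x ∈ Tn g M lam s n | ¬ Function.Injective x}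

def Vr (g : ℕ) (r₁ : ℕ) : Set (Fin (2 * g + 1) → ℕ) :=
  {v | (∀ i, 0 < v i) ∧
    (∀ t : ℕ, ∀ _ : t < g,
      r₁ + v ⟨0, by omega⟩ = v ⟨2 * t + 1, by omega⟩ + v ⟨2 * t + 2, by omega⟩) ∧
    (∀ i, v i ≤ r₁) ∧ Function.Injective v ∧ (∀ i, v i ≠ r₁)}

def Tcal (X r : Finset ℕ) (k : ℕ) (eps : ℕ → ℤ) : Set (ℕ → ℕ) :=
  {y | (∀ j < k, y j ∈ X ∪ r) ∧ (∀ j, k ≤ j → y j = 0) ∧ (∃ j < k, y j ∈ X) ∧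
    (∀ i < k, ∀ j < k, y i = y j → eps i = eps j)}

def Fval (k : ℕ) (eps : ℕ → ℤ) (y : ℕ → ℕ) : ℤ :=
  ∑ j ∈ Finset.range k, eps j * (y j : ℤ)

def Ccal (U X r : Finset ℕ) : Set (Finset ℕ) :=
  {w | w.card = 4 ∧ w ⊆ U ∧ (∃ a ∈ w, a ∈ X ∧ a ∉ r) ∧
    ∃ y₁ y₂ y₃ y₄ : ℕ, w = {y₁, y₂, y₃, y₄} ∧ y₁ + y₂ = y₃ + y₄ ∧
      ({y₁, y₂} : Finset ℕ) ≠ {y₃, y₄}}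

def CcalR (g M : ℕ) (lam : ℝ) (s : ℕ → Fin 3 → ZMod M) (n : ℕ) (X r : Finset ℕ) :
    Set (Finset ℕ) :=
  {w | w ∈ Rn g M lam s n ∧ w ⊆ X ∪ r ∧ ∃ a ∈ w, a ∈ X ∧ a ∉ r}

def Sx (g : ℕ) (x : Fin (2 * g + 4) → ℕ) : Set (Finset ℕ) :=
  {w | ∃ l : ℕ, ∃ _ : 3 ≤ l, ∃ _ : l ≤ g + 2,
      w = ({x ⟨0, by omega⟩, x ⟨3, by omega⟩,
            x ⟨2 * l - 2, by omega⟩, x ⟨2 * l - 1, by omega⟩} : Finset ℕ)} ∪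
  {w | ∃ l j : ℕ, ∃ _ : 3 ≤ l, ∃ _ : l < j, ∃ _ : j ≤ g + 2,
      w = ({x ⟨2 * j - 2, by omega⟩, x ⟨2 * j - 1, by omega⟩,
            x ⟨2 * l - 2, by omega⟩, x ⟨2 * l - 1, by omega⟩} : Finset ℕ)}

def SxV (g : ℕ) (r₁ : ℕ) (v : Fin (2 * g + 1) → ℕ) : Set (Finset ℕ) :=
  {w | ∃ l : ℕ, ∃ _ : 3 ≤ l, ∃ _ : l ≤ g + 2,
      w = ({r₁, v ⟨0, by omega⟩, v ⟨2 * l - 5, by omega⟩, v ⟨2 * l - 4, by omega⟩} : Finset ℕ)} ∪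
  {w | ∃ l j : ℕ, ∃ _ : 3 ≤ l, ∃ _ : l < j, ∃ _ : j ≤ g + 2,
      w = ({v ⟨2 * j - 5, by omega⟩, v ⟨2 * j - 4, by omega⟩,
            v ⟨2 * l - 5, by omega⟩, v ⟨2 * l - 4, by omega⟩} : Finset ℕ)}

def tailSet (g : ℕ) (x : Fin (2 * g + 4) → ℕ) : Finset ℕ :=
  Finset.image (fun i : Fin (2 * g + 1) => x ⟨(i : ℕ) + 3, by have := i.isLt; omega⟩)
    Finset.univ

theorem mul_rpow_neg_le_rpow_sub {a : ℝ} (ha0 : 0 < a) (ha1 : a < 1) (m : ℕ) :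
    (1 - a) * ((m + 1 : ℕ) : ℝ) ^ (-a) ≤ ((m + 1 : ℕ) : ℝ) ^ (1 - a) - (m : ℝ) ^ (1 - a) := by
  have hpos : (0 : ℝ) < (m : ℝ) + 1 := by positivity
  have hle : 1 / ((m : ℝ) + 1) ≤ 1 := by
    rw [div_le_one hpos]
    linarith [Nat.cast_nonneg (α := ℝ) m]
  have hb := rpow_one_add_le_one_add_mul_self (s := -(1 / ((m : ℝ) + 1))) (p := 1 - a)
    (by linarith) (by linarith) (by linarith)
  have hm : (m : ℝ) = ((m : ℝ) + 1) * (1 + -(1 / ((m : ℝ) + 1))) := by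
    field_simp
    ring
  have h1 : (m : ℝ) ^ (1 - a)
      = ((m : ℝ) + 1) ^ (1 - a) * (1 + -(1 / ((m : ℝ) + 1))) ^ (1 - a) := by
    rw [← Real.mul_rpow hpos.le (by linarith), ← hm]
  have h2 : ((m : ℝ) + 1) ^ (-a) = ((m : ℝ) + 1) ^ (1 - a) / ((m : ℝ) + 1) := by
    rw [← Real.rpow_sub_one hpos.ne']
    congr 1
    ring
  have h3 := mul_le_mul_of_nonneg_left hb (Real.rpow_nonneg hpos.le (1 - a))
  push_cast
  rw [h1, h2]
  have h4 : ((m : ℝ) + 1) ^ (1 - a) * (1 + (1 - a) * -(1 / ((m : ℝ) + 1)))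
      = ((m : ℝ) + 1) ^ (1 - a) - (1 - a) * (((m : ℝ) + 1) ^ (1 - a) / ((m : ℝ) + 1)) := by
    ring
  linarith

theorem sum_range_rpow_neg_le {a : ℝ} (ha0 : 0 < a) (ha1 : a < 1) (m : ℕ) :
    ∑ x ∈ Finset.range (m + 1), (x : ℝ) ^ (-a) ≤ (m : ℝ) ^ (1 - a) / (1 - a) := by
  have hb : 0 < 1 - a := by linarith
  induction m with
  | zero => simp [Real.zero_rpow hb.ne', Real.zero_rpow (neg_ne_zero.mpr ha0.ne')]
  | succ m ih =>
    rw [Finset.sum_range_succ]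
    have h := mul_rpow_neg_le_rpow_sub ha0 ha1 m
    rw [le_div_iff₀ hb] at ih ⊢
    linarith

theorem rpow_neg_mul_rpow_neg_le {a : ℝ} (ha0 : 0 < a) {S y : ℕ} (hS : 0 < S) :
    (y : ℝ) ^ (-a) * ((S - y : ℕ) : ℝ) ^ (-a)
      ≤ ((S : ℝ) / 2) ^ (-a) * ((y : ℝ) ^ (-a) + ((S - y : ℕ) : ℝ) ^ (-a)) := by
  have hS' : (0 : ℝ) < (S : ℝ) / 2 := by positivity
  have hy0 : (0 : ℝ) ≤ (y : ℝ) ^ (-a) := by positivity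
  have hz0 : (0 : ℝ) ≤ ((S - y : ℕ) : ℝ) ^ (-a) := by positivity
  have hc0 : (0 : ℝ) ≤ ((S : ℝ) / 2) ^ (-a) := by positivity
  rcases le_total (S : ℝ) (2 * y) with h | h
  · have := Real.rpow_le_rpow_of_nonpos hS' (show (S : ℝ) / 2 ≤ y by linarith)
      (show -a ≤ 0 by linarith)
    nlinarith
  · have hle : y ≤ S := by
      have : S ≥ 2 * y := by exact_mod_cast h
      omega
    have := Real.rpow_le_rpow_of_nonpos hS'
      (show (S : ℝ) / 2 ≤ ((S - y : ℕ) : ℝ) by push_cast [hle]; linarith)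
      (show -a ≤ 0 by linarith)
    nlinarith

theorem sum_rpow_neg_convolution_le {a : ℝ} (ha0 : 0 < a) (ha1 : a < 1) {S : ℕ} (hS : 0 < S)
    (N : ℕ) :
    ∑ y ∈ Finset.range N, (y : ℝ) ^ (-a) * ((S - y : ℕ) : ℝ) ^ (-a)
      ≤ 2 * 2 ^ a / (1 - a) * (S : ℝ) ^ (1 - 2 * a) := by
  have hSR : (0 : ℝ) < S := by exact_mod_cast hS
  calc ∑ y ∈ Finset.range N, (y : ℝ) ^ (-a) * ((S - y : ℕ) : ℝ) ^ (-a)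
      ≤ ∑ y ∈ Finset.range (S + 1), (y : ℝ) ^ (-a) * ((S - y : ℕ) : ℝ) ^ (-a) := by
        rw [← Finset.sum_filter_ne_zero (Finset.range N)]
        refine Finset.sum_le_sum_of_subset_of_nonneg (fun y hy => ?_) fun y _ _ => by positivity
        by_contra hlt
        apply (Finset.mem_filter.mp hy).2
        have : S - y = 0 := by
          rw [Finset.mem_range] at hlt
          omega
        rw [this, Nat.cast_zero, Real.zero_rpow (neg_ne_zero.mpr ha0.ne'), mul_zero]
    _ ≤ ∑ y ∈ Finset.range (S + 1),
          ((S : ℝ) / 2) ^ (-a) * ((y : ℝ) ^ (-a) + ((S - y : ℕ) : ℝ) ^ (-a)) :=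
        Finset.sum_le_sum fun y _ => rpow_neg_mul_rpow_neg_le ha0 hS
    _ = ((S : ℝ) / 2) ^ (-a) * (2 * ∑ y ∈ Finset.range (S + 1), (y : ℝ) ^ (-a)) := by
        have := Finset.sum_range_reflect (fun y : ℕ => (y : ℝ) ^ (-a)) (S + 1)
        simp only [Nat.add_sub_cancel] at this
        rw [← Finset.mul_sum, Finset.sum_add_distrib, this]
        ring
    _ ≤ ((S : ℝ) / 2) ^ (-a) * (2 * ((S : ℝ) ^ (1 - a) / (1 - a))) := by
        gcongr
        exact sum_range_rpow_neg_le ha0 ha1 S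
    _ = 2 * 2 ^ a / (1 - a) * (S : ℝ) ^ (1 - 2 * a) := by
        rw [Real.div_rpow hSR.le zero_le_two, Real.rpow_neg zero_le_two,
          show 1 - 2 * a = -a + (1 - a) by ring, Real.rpow_add hSR]
        field_simp

theorem sum_pairs_le {a : ℝ} (ha0 : 0 < a) (ha1 : a < 1) (h2a : 1 ≤ 2 * a) {g : ℕ}
    (hga : (g : ℝ) * (1 - 2 * a) + (1 - a) = 0) {r : ℕ} (hr : 0 < r) (N : ℕ) :
    ∑ d ∈ Finset.range (r + 1), (d : ℝ) ^ (-a) *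
        (∑ y ∈ Finset.range N, (y : ℝ) ^ (-a) * ((r + d - y : ℕ) : ℝ) ^ (-a)) ^ g
      ≤ (2 * 2 ^ a / (1 - a)) ^ g / (1 - a) := by
  have hrR : (0 : ℝ) < r := by exact_mod_cast hr
  have hb : 0 < 1 - a := by linarith
  calc _ ≤ ∑ d ∈ Finset.range (r + 1), (d : ℝ) ^ (-a) *
        (2 * 2 ^ a / (1 - a) * (r : ℝ) ^ (1 - 2 * a)) ^ g := by
        refine Finset.sum_le_sum fun d _ => ?_
        gcongr
        refine (sum_rpow_neg_convolution_le ha0 ha1 (S := r + d) (by omega) N).trans ?_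
        refine mul_le_mul_of_nonneg_left ?_ (by positivity)
        exact Real.rpow_le_rpow_of_nonpos hrR (by push_cast; linarith [d.cast_nonneg (α := ℝ)])
          (by linarith)
    _ ≤ (r : ℝ) ^ (1 - a) / (1 - a) * (2 * 2 ^ a / (1 - a) * (r : ℝ) ^ (1 - 2 * a)) ^ g := by
        rw [← Finset.sum_mul]
        gcongr
        exact sum_range_rpow_neg_le ha0 ha1 r
    _ = (2 * 2 ^ a / (1 - a)) ^ g / (1 - a) := by
        have h : (r : ℝ) ^ (1 - a) * ((r : ℝ) ^ (1 - 2 * a)) ^ g = 1 := by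
          rw [← Real.rpow_mul_natCast hrR.le, ← Real.rpow_add hrR,
            show 1 - a + (1 - 2 * a) * g = 0 by linarith, Real.rpow_zero]
        rw [mul_pow]
        linear_combination (2 * 2 ^ a / (1 - a)) ^ g / (1 - a) * h

theorem tsum_subtype_le_sum_of_subset_image {X Z : Type*} {T : Set X} {F : Finset Z} (ψ : Z → X)
    (hT : ∀ x ∈ T, ∃ z ∈ F, ψ z = x) {f : X → ℝ} (hf : ∀ x, 0 ≤ f x) :
    ∑' x : ↥T, f x ≤ ∑ z ∈ F, f (ψ z) := by
  classical
  have hsub : T ⊆ ↑(F.image ψ) := fun x hx => by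
    obtain ⟨z, hz, rfl⟩ := hT x hx
    exact Finset.mem_coe.mpr (Finset.mem_image_of_mem ψ hz)
  have hfin : T.Finite := (F.image ψ).finite_toSet.subset hsub
  lift T to Finset X using hfin
  rw [Finset.tsum_subtype' T f]
  calc ∑ x ∈ T, f x ≤ ∑ x ∈ F.image ψ, f x :=
        Finset.sum_le_sum_of_subset_of_nonneg (Finset.coe_subset.mp hsub) fun x _ _ => hf x
    _ ≤ ∑ z ∈ F, f (ψ z) := Finset.sum_image_le_of_nonneg fun _ _ => hf _

theorem prod_range_two_mul_add_four {R : Type*} [CommMonoid R] (f : ℕ → R) (g : ℕ) :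
    ∏ i ∈ Finset.range (2 * g + 4), f i
      = (f 0 * f 1 * f 2) * f 3 * ∏ k ∈ Finset.range g, (f (2 * k + 4) * f (2 * k + 5)) := by
  induction g with
  | zero => simp [Finset.prod_range_succ]
  | succ g ih =>
    rw [show 2 * (g + 1) + 4 = 2 * g + 4 + 1 + 1 by ring, Finset.prod_range_succ,
      Finset.prod_range_succ, ih, Finset.prod_range_succ]
    simp only [mul_assoc]

/-- The sequence `t 0, t 1, t 2, d, y 0, t 0 + d - y 0, y 1, t 0 + d - y 1, …`. -/
def assemble {g : ℕ} (t : Fin 3 → ℕ) (d : ℕ) (y : Fin g → ℕ) (i : ℕ) : ℕ :=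
  if h : i < 3 then t ⟨i, h⟩
  else if i = 3 then d
  else if h : (i - 4) / 2 < g then
    if i % 2 = 0 then y ⟨(i - 4) / 2, h⟩ else t 0 + d - y ⟨(i - 4) / 2, h⟩
  else 0

theorem assemble_even {g : ℕ} (t : Fin 3 → ℕ) (d : ℕ) (y : Fin g → ℕ) (k : Fin g) :
    assemble t d y (2 * k + 4) = y k := by
  have h1 : ¬ (2 * (k : ℕ) + 4 < 3) := by omega
  have h2 : ¬ (2 * (k : ℕ) + 4 = 3) := by omega
  have h4 : (2 * (k : ℕ) + 4) % 2 = 0 := by omega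
  simp [assemble, h1, h2, h4]

theorem assemble_odd {g : ℕ} (t : Fin 3 → ℕ) (d : ℕ) (y : Fin g → ℕ) (k : Fin g) :
    assemble t d y (2 * k + 5) = t 0 + d - y k := by
  have h1 : ¬ (2 * (k : ℕ) + 5 < 3) := by omega
  have h2 : ¬ (2 * (k : ℕ) + 5 = 3) := by omega
  have h3 : (2 * (k : ℕ) + 1) / 2 = k := by omega
  simp [assemble, h1, h2, h3]

theorem prod_assemble {R : Type*} [CommMonoid R] {g : ℕ} (w : ℕ → R) (t : Fin 3 → ℕ) (d : ℕ)
    (y : Fin g → ℕ) :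
    ∏ i : Fin (2 * g + 4), w (assemble t d y i)
      = (∏ i, w (t i)) * (w d * ∏ k : Fin g, (w (y k) * w (t 0 + d - y k))) := by
  rw [Fin.prod_univ_eq_prod_range (fun i => w (assemble t d y i)) (2 * g + 4),
    prod_range_two_mul_add_four, ← Fin.prod_univ_eq_prod_range
      (fun k => w (assemble t d y (2 * k + 4)) * w (assemble t d y (2 * k + 5))) g]
  simp only [assemble_even, assemble_odd]
  rw [Fin.prod_univ_three, mul_assoc]
  rfl

theorem exists_perm_of_subset {t u : Fin 3 → ℕ} (ht : Function.Injective t)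
    (h : ∀ i, ∃ j, t i = u j) : ∃ σ : Equiv.Perm (Fin 3), t = u ∘ σ := by
  choose f hf using h
  have hinj : Function.Injective f := fun i j hij => ht (by rw [hf, hf, hij])
  exact ⟨Equiv.ofBijective f (Finite.injective_iff_bijective.mp hinj), funext hf⟩

open Classical in
/-- The first two entries `(p, q)` of the ordered triples counted by `Rtrip`. -/
def tripleFirstTwo (g M : ℕ) (lam : ℝ) (s : ℕ → Fin 3 → ZMod M) (n : ℕ) : Finset (ℕ × ℕ) :=
  (Finset.range (⌊glam g lam n⌋₊ + 1) ×ˢ Finset.range (n + 1)).filter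
    fun p => Rtrip g M lam s n p.1 p.2 (n - p.1 - p.2)

theorem rtrip_of_mem_tripleFirstTwo {g M : ℕ} {lam : ℝ} {s : ℕ → Fin 3 → ZMod M} {n : ℕ}
    {p : ℕ × ℕ} (hp : p ∈ tripleFirstTwo g M lam s n) :
    Rtrip g M lam s n p.1 p.2 (n - p.1 - p.2) := by
  classical
  exact (Finset.mem_filter.mp hp).2

theorem sum_tripleFirstTwo_le {a : ℝ} (ha0 : 0 < a) (ha1 : a < 1) (g M : ℕ) {lam : ℝ}
    (hlam : 0 < lam) (s : ℕ → Fin 3 → ZMod M) {n : ℕ} (hn : 1 ≤ n) :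
    ∑ p ∈ tripleFirstTwo g M lam s n,
        ((p.1 : ℝ) ^ (-a) * (p.2 : ℝ) ^ (-a) * ((n - p.1 - p.2 : ℕ) : ℝ) ^ (-a))
      ≤ 2 * 4 ^ (2 * a) / (1 - a) * (glam g lam n ^ (1 - a) * (n : ℝ) ^ (1 - 2 * a)) := by
  have hnR : (1 : ℝ) ≤ n := by exact_mod_cast hn
  have hn0 : (0 : ℝ) < n := by linarith
  have hb : 0 < 1 - a := by linarith
  have hG : 0 ≤ glam g lam n := by
    have := Real.log_nonneg hnR
    unfold glam
    positivity
  calc _ ≤ ∑ p ∈ tripleFirstTwo g M lam s n,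
        ((p.1 : ℝ) ^ (-a) * ((n : ℝ) / 4) ^ (-a) * ((n : ℝ) / 4) ^ (-a)) := by
        refine Finset.sum_le_sum fun p hp => ?_
        obtain ⟨-, -, -, -, -, -, h2, -, h3, -⟩ := rtrip_of_mem_tripleFirstTwo hp
        have e2 := Real.rpow_le_rpow_of_nonpos (by positivity) h2 (show -a ≤ 0 by linarith)
        have e3 := Real.rpow_le_rpow_of_nonpos (by positivity) h3 (show -a ≤ 0 by linarith)
        gcongr
    _ ≤ ∑ p ∈ Finset.range (⌊glam g lam n⌋₊ + 1) ×ˢ Finset.range (n + 1),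
        ((p.1 : ℝ) ^ (-a) * ((n : ℝ) / 4) ^ (-a) * ((n : ℝ) / 4) ^ (-a)) := by
        refine Finset.sum_le_sum_of_subset_of_nonneg
          (by classical exact Finset.filter_subset _ _) fun p _ _ => ?_
        positivity
    _ = (∑ x ∈ Finset.range (⌊glam g lam n⌋₊ + 1), (x : ℝ) ^ (-a)) *
          ((n + 1) * (((n : ℝ) / 4) ^ (-a) * ((n : ℝ) / 4) ^ (-a))) := by
        rw [Finset.sum_product, Finset.sum_mul]
        refine Finset.sum_congr rfl fun x _ => ?_
        simp only [Finset.sum_const, Finset.card_range, nsmul_eq_mul]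
        push_cast
        ring
    _ ≤ (glam g lam n ^ (1 - a) / (1 - a)) *
          ((2 * n) * (((n : ℝ) / 4) ^ (-a) * ((n : ℝ) / 4) ^ (-a))) := by
        have h1 : (∑ x ∈ Finset.range (⌊glam g lam n⌋₊ + 1), (x : ℝ) ^ (-a))
            ≤ glam g lam n ^ (1 - a) / (1 - a) := by
          refine (sum_range_rpow_neg_le ha0 ha1 _).trans ?_
          gcongr
          exact Nat.floor_le hG
        gcongr
        linarith
    _ = 2 * 4 ^ (2 * a) / (1 - a) * (glam g lam n ^ (1 - a) * (n : ℝ) ^ (1 - 2 * a)) := by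
        have h4 : ((n : ℝ) / 4) ^ (-a) * ((n : ℝ) / 4) ^ (-a)
            = 4 ^ (2 * a) * (n : ℝ) ^ (-(2 * a)) := by
          rw [← Real.rpow_add (by positivity), show -a + -a = -(2 * a) by ring,
            Real.div_rpow hn0.le (by norm_num), Real.rpow_neg (by norm_num : (0 : ℝ) ≤ 4)]
          field_simp
        rw [h4, sub_eq_add_neg 1 (2 * a), Real.rpow_add hn0, Real.rpow_one]
        ring

/-- The ordered triple with sum `n` and first two entries `p`. -/
def completeTriple (n : ℕ) (p : ℕ × ℕ) : Fin 3 → ℕ := ![p.1, p.2, n - p.1 - p.2]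

theorem exists_assemble_eq {g M : ℕ} {lam : ℝ} {s : ℕ → Fin 3 → ZMod M} {n : ℕ}
    {x : Fin (2 * g + 4) → ℕ} (hx : x ∈ TnInd g M lam s n) :
    ∃ p ∈ tripleFirstTwo g M lam s n, ∃ σ : Equiv.Perm (Fin 3), ∃ d y,
      d ≤ completeTriple n p (σ 0) ∧ (∀ k : Fin g, y k < n + 1) ∧
      (fun i : Fin (2 * g + 4) => assemble (completeTriple n p ∘ σ) d y i) = x := by
  obtain ⟨⟨-, ⟨x₁, x₂, x₃, hset, hR⟩, hsum, hle, -, -⟩, hinj⟩ := hx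
  let t : Fin 3 → ℕ := fun i => x ⟨i, by omega⟩
  have hx₃ : n - x₁ - x₂ = x₃ := by
    have := hR.2.2.2.1
    omega
  have hu : completeTriple n (x₁, x₂) = ![x₁, x₂, x₃] := by
    simp only [completeTriple, hx₃]
  have ht : Function.Injective t := fun i j hij => by
    have := hinj hij
    simp only [Fin.mk.injEq] at this
    exact Fin.ext this
  have hmem : ∀ i, ∃ j, t i = completeTriple n (x₁, x₂) j := by
    intro i
    have hi : t i ∈ firstThree g x := by
      fin_cases i <;> simp [t, firstThree]
    rw [hset] at hi
    simp only [Finset.mem_insert, Finset.mem_singleton] at hi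
    rw [hu]
    rcases hi with h | h | h
    · exact ⟨0, h⟩
    · exact ⟨1, h⟩
    · exact ⟨2, h⟩
  obtain ⟨σ, hσ⟩ := exists_perm_of_subset ht hmem
  have h0 : x ⟨0, by omega⟩ = completeTriple n (x₁, x₂) (σ 0) := congrFun hσ 0
  have hn0 : x ⟨0, by omega⟩ ≤ n := by
    rw [h0, hu]
    have := hR.2.2.2.1
    generalize σ 0 = j
    fin_cases j <;> simp <;> omega
  refine ⟨(x₁, x₂), ?_, σ, x ⟨3, by omega⟩, fun k => x ⟨2 * k + 4, by omega⟩, ?_, ?_, ?_⟩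
  · simp only [tripleFirstTwo, Finset.mem_filter, Finset.mem_product, Finset.mem_range, hx₃]
    refine ⟨⟨Nat.lt_succ_of_le (Nat.le_floor hR.2.2.2.2.2.1), ?_⟩, hR⟩
    have := hR.2.2.2.1
    omega
  · rw [← h0]
    exact hle _ le_rfl
  · exact fun k => Nat.lt_succ_of_le ((hle _ (show 3 ≤ 2 * (k : ℕ) + 4 by omega)).trans hn0)
  · rw [← hσ]
    funext ⟨i, hi⟩
    simp only
    rcases lt_or_ge i 4 with h4 | h4
    · interval_cases i <;> rfl
    · rcases Nat.even_or_odd' i with ⟨j, rfl | rfl⟩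
      · obtain ⟨k, rfl⟩ : ∃ k, j = k + 2 := ⟨j - 2, by omega⟩
        exact assemble_even t _ (fun k : Fin g => x ⟨2 * k + 4, by omega⟩) ⟨k, by omega⟩
      · obtain ⟨k, rfl⟩ : ∃ k, j = k + 2 := ⟨j - 2, by omega⟩
        refine (assemble_odd t _ (fun k : Fin g => x ⟨2 * k + 4, by omega⟩)
          ⟨k, by omega⟩).trans ?_
        have := hsum (k + 2) (by omega) (by omega)
        exact Nat.sub_eq_of_eq_add (this.trans (Nat.add_comm _ _))

theorem tsum_TnInd_le {a : ℝ} (ha0 : 0 < a) (ha1 : a < 1) (h2a : 1 ≤ 2 * a) {g : ℕ}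
    (hga : (g : ℝ) * (1 - 2 * a) + (1 - a) = 0) (M : ℕ) {lam : ℝ} (hlam : 0 < lam)
    (s : ℕ → Fin 3 → ZMod M) {n : ℕ} (hn : 1 ≤ n) :
    ∑' x : ↥(TnInd g M lam s n), ∏ i : Fin (2 * g + 4), (x.1 i : ℝ) ^ (-a)
      ≤ 6 * (2 * 4 ^ (2 * a) / (1 - a)) * ((2 * 2 ^ a / (1 - a)) ^ g / (1 - a)) *
        (glam g lam n ^ (1 - a) * (n : ℝ) ^ (1 - 2 * a)) := by
  have hb : 0 < 1 - a := by linarith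
  let F : Finset (Σ _ : (ℕ × ℕ) × Equiv.Perm (Fin 3), ℕ × (Fin g → ℕ)) :=
    (tripleFirstTwo g M lam s n ×ˢ Finset.univ).sigma fun z =>
      Finset.range (completeTriple n z.1 (z.2 0) + 1) ×ˢ
        Fintype.piFinset fun _ => Finset.range (n + 1)
  refine (tsum_subtype_le_sum_of_subset_image (F := F)
    (f := fun x : Fin (2 * g + 4) → ℕ => ∏ i, (x i : ℝ) ^ (-a))
    (fun z i => assemble (completeTriple n z.1.1 ∘ z.1.2) z.2.1 z.2.2 (i : Fin (2 * g + 4)))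
    (fun x hx => ?_) (fun x => by positivity)).trans ?_
  · obtain ⟨p, hp, σ, d, y, hd, hy, rfl⟩ := exists_assemble_eq hx
    exact ⟨⟨(p, σ), (d, y)⟩, by simp [F, hp, hd, fun k => Nat.le_of_lt_succ (hy k)],
      rfl⟩
  have hinner : ∀ z ∈ tripleFirstTwo g M lam s n ×ˢ (Finset.univ : Finset (Equiv.Perm (Fin 3))),
      ∑ v ∈ Finset.range (completeTriple n z.1 (z.2 0) + 1) ×ˢ
          Fintype.piFinset fun _ : Fin g => Finset.range (n + 1),
        ∏ i : Fin (2 * g + 4),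
          ((assemble (completeTriple n z.1 ∘ z.2) v.1 v.2 i : ℕ) : ℝ) ^ (-a)
      ≤ ((z.1.1 : ℝ) ^ (-a) * (z.1.2 : ℝ) ^ (-a) * ((n - z.1.1 - z.1.2 : ℕ) : ℝ) ^ (-a)) *
        ((2 * 2 ^ a / (1 - a)) ^ g / (1 - a)) := by
    rintro ⟨p, σ⟩ hz
    have hp := (Finset.mem_product.mp hz).1
    have hR := rtrip_of_mem_tripleFirstTwo hp
    have hpos : 0 < completeTriple n p (σ 0) := by
      simp only [completeTriple]
      generalize σ 0 = j
      fin_cases j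
      · exact hR.1
      · exact hR.2.1
      · exact hR.2.2.1
    have hperm : ∏ i, ((completeTriple n p (σ i) : ℕ) : ℝ) ^ (-a)
        = (p.1 : ℝ) ^ (-a) * (p.2 : ℝ) ^ (-a) * ((n - p.1 - p.2 : ℕ) : ℝ) ^ (-a) := by
      rw [Equiv.prod_comp σ (fun i => ((completeTriple n p i : ℕ) : ℝ) ^ (-a)),
        Fin.prod_univ_three]
      rfl
    simp only [prod_assemble (fun m : ℕ => (m : ℝ) ^ (-a)), Function.comp_apply, hperm]
    rw [← Finset.mul_sum, Finset.sum_product]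
    refine mul_le_mul_of_nonneg_left ?_ (by positivity)
    refine le_of_eq_of_le (Finset.sum_congr rfl fun d _ => ?_)
      (sum_pairs_le ha0 ha1 h2a hga hpos (n + 1))
    simp only
    rw [← Finset.mul_sum, ← Finset.prod_univ_sum (fun _ : Fin g => Finset.range (n + 1))
      (fun _ m => (m : ℝ) ^ (-a) * ((completeTriple n p (σ 0) + d - m : ℕ) : ℝ) ^ (-a)),
      Finset.prod_const, Finset.card_univ, Fintype.card_fin]
  rw [Finset.sum_sigma]
  refine (Finset.sum_le_sum hinner).trans ?_
  rw [← Finset.sum_mul, Finset.sum_product]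
  simp only [Finset.sum_const, Finset.card_univ, Fintype.card_perm, Fintype.card_fin,
    nsmul_eq_mul]
  rw [← Finset.mul_sum, show ((Nat.factorial 3 : ℕ) : ℝ) = 6 by norm_num [Nat.factorial]]
  have h := sum_tripleFirstTwo_le ha0 ha1 g M hlam s hn
  have hc : 0 ≤ (2 * 2 ^ a / (1 - a)) ^ g / (1 - a) := by positivity
  calc _ ≤ 6 * (2 * 4 ^ (2 * a) / (1 - a) * (glam g lam n ^ (1 - a) * (n : ℝ) ^ (1 - 2 * a))) *
        ((2 * 2 ^ a / (1 - a)) ^ g / (1 - a)) := by gcongr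
    _ = _ := by ring

theorem one_sub_alph (g : ℕ) : 1 - alph g = (g : ℝ) / (2 * g + 1) := by
  unfold alph
  field_simp
  ring

theorem glam_rpow_mul {g : ℕ} (hg : 0 < g) {lam : ℝ} (hlam : 0 < lam) {n : ℕ} (hn : 1 ≤ n) :
    glam g lam n ^ (1 - alph g) * (n : ℝ) ^ (1 - 2 * alph g)
      = lam ^ (2 * g + 5) * Real.log n := by
  have hgR : (0 : ℝ) < g := by exact_mod_cast hg
  have hnR : (1 : ℝ) ≤ n := by exact_mod_cast hn
  have hn0 : (0 : ℝ) < n := by linarith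
  have hlog := Real.log_nonneg hnR
  have hb : 0 < 1 - alph g := by
    rw [one_sub_alph]
    positivity
  have he : 1 / (g : ℝ) * (1 - alph g) + (1 - 2 * alph g) = 0 := by
    unfold alph
    field_simp
    ring
  have h5 : (2 * (g : ℝ) + 5) = ((2 * g + 5 : ℕ) : ℝ) := by push_cast; ring
  unfold glam
  rw [Real.mul_rpow (by positivity) (by positivity), Real.mul_rpow (by positivity) (by positivity),
    ← Real.rpow_mul hlam.le, ← Real.rpow_mul hn0.le, ← Real.rpow_mul hlog,
    div_mul_cancel₀ _ hb.ne', div_mul_cancel₀ _ hb.ne', Real.rpow_one, h5, Real.rpow_natCast]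
  have h : (n : ℝ) ^ (1 / (g : ℝ) * (1 - alph g)) * (n : ℝ) ^ (1 - 2 * alph g) = 1 := by
    rw [← Real.rpow_add hn0, he, Real.rpow_zero]
  linear_combination lam ^ (2 * g + 5) * Real.log n * h

theorem stmt10 (g M : ℕ) (hg : 2 ≤ g) (hM : 1 ≤ M) (CM : Set (ZMod M))
    (hSidon : IsSidonZ CM) (hcov : Covers3 CM) :
    ∃ C : ℝ, 0 < C ∧
      ∀ s : ℕ → Fin 3 → ZMod M, GoodS M CM s →
      ∀ lam : ℝ, 1 < lam → ∃ n₀ : ℕ, ∀ n : ℕ, n₀ ≤ n →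
        (∑' x : ↥(TnInd g M lam s n),
            ∏ i : Fin (2 * g + 4), lam⁻¹ * (x.1 i : ℝ) ^ (-alph g))
          ≤ C * lam * Real.log n := by
  have hg0 : 0 < g := by omega
  have hgR : (0 : ℝ) < g := by exact_mod_cast hg0
  have ha0 : 0 < alph g := by
    unfold alph
    positivity
  have hb : 0 < 1 - alph g := by
    rw [one_sub_alph]
    positivity
  have h2a : 1 ≤ 2 * alph g := by
    unfold alph
    rw [← mul_div_assoc, le_div_iff₀ (by positivity)]
    linarith
  have hga : (g : ℝ) * (1 - 2 * alph g) + (1 - alph g) = 0 := by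
    unfold alph
    field_simp
    ring
  refine ⟨6 * (2 * 4 ^ (2 * alph g) / (1 - alph g)) *
    ((2 * 2 ^ alph g / (1 - alph g)) ^ g / (1 - alph g)), by positivity, ?_⟩
  intro s _ lam hlam
  have hlam0 : 0 < lam := by linarith
  refine ⟨1, fun n hn => ?_⟩
  have h := tsum_TnInd_le ha0 (by linarith) h2a hga M hlam0 s hn
  rw [glam_rpow_mul hg0 hlam0 hn] at h
  simp only [Finset.prod_mul_distrib, Finset.prod_const, Finset.card_univ, Fintype.card_fin]
  rw [tsum_mul_left]
  refine (mul_le_mul_of_nonneg_left h (by positivity)).trans_eq ?_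
  have hpow : lam⁻¹ ^ (2 * g + 4) * lam ^ (2 * g + 5) = lam := by
    rw [pow_succ lam (2 * g + 4), ← mul_assoc, ← mul_pow, inv_mul_cancel₀ hlam0.ne', one_pow,
      one_mul]
  linear_combination (6 * (2 * 4 ^ (2 * alph g) / (1 - alph g)) *
    ((2 * 2 ^ alph g / (1 - alph g)) ^ g / (1 - alph g))) * Real.log n * hpow
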